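/- Overhearing the cross-link is better in the weak interference regime: For nonnegative integers n, m, f, θ with 3m ≤ 2n, the sum capacity of the deterministic two-hop interference channel with parameters (n, m, f, n̄ = 0, m̄ = θ) is greater than or equal to the sum capacity of the channel with parameters (n, m, f, n̄ = θ, m̄ = 0). -/

import Mathlib

open scoped Classical

namespace TwoHopIC

/-- The `q × q` lower-shift matrix `S^k` over `F₂`, with `(S^k)_{i,j} = 1` iff `i = j + k`. -/
def shiftMat (q k : ℕ) : Matrix (Fin q) (Fin q) (ZMod 2) :=
  Matrix.of fun i j => if (i : ℕ) = (j : ℕ) + k then 1 else 0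

/-- Forward (first-hop) signal alphabet: vectors in `F₂^q` with `q = max m n`. -/
abbrev FSig (n m : ℕ) := Fin (max m n) → ZMod 2

/-- Backward/second-hop signal alphabet: vectors in `F₂^q̄` with `q̄ = max(m̄, n̄, f)`. -/
abbrev BSig (f nb mb : ℕ) := Fin (max mb (max nb f)) → ZMod 2

/-- A blocklength-`N` code with message sets of sizes `M1`, `M2`:
causal encoders at the sources (using the messages and the overheard signals),
causal encoders at the relays (using their received signals), and decoders at the
destinations (using the `N` received signals). -/
structure Code (n m f nb mb N M1 M2 : ℕ) where
  encS1 : (t : ℕ) → Fin M1 → (Fin t → BSig f nb mb) → FSig n m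
  encS2 : (t : ℕ) → Fin M2 → (Fin t → BSig f nb mb) → FSig n m
  encR1 : (t : ℕ) → (Fin t → FSig n m) → BSig f nb mb
  encR2 : (t : ℕ) → (Fin t → FSig n m) → BSig f nb mb
  dec1 : (Fin N → BSig f nb mb) → Fin M1
  dec2 : (Fin N → BSig f nb mb) → Fin M2

variable {n m f nb mb N M1 M2 : ℕ}

/-- Given a history `h` of source signals `(X_{S1}[·], X_{S2}[·])`, the signal received by
relay 1 at time `s`: `Y_{R1}[s] = S^{q-n} X_{S1}[s] ⊕ S^{q-m} X_{S2}[s]`. -/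
def relayRx1 (n m : ℕ) {t : ℕ} (h : Fin t → FSig n m × FSig n m) (s : Fin t) : FSig n m :=
  (shiftMat (max m n) (max m n - n)).mulVec (h s).1 +
  (shiftMat (max m n) (max m n - m)).mulVec (h s).2

/-- `Y_{R2}[s] = S^{q-m} X_{S1}[s] ⊕ S^{q-n} X_{S2}[s]`. -/
def relayRx2 (n m : ℕ) {t : ℕ} (h : Fin t → FSig n m × FSig n m) (s : Fin t) : FSig n m :=
  (shiftMat (max m n) (max m n - m)).mulVec (h s).1 +
  (shiftMat (max m n) (max m n - n)).mulVec (h s).2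

/-- Relay 1 transmitted signal `X_{R1}[s]`, a causal function of `Y_{R1}[1..s-1]`. -/
def relayTx1 (C : Code n m f nb mb N M1 M2) {t : ℕ}
    (h : Fin t → FSig n m × FSig n m) (s : Fin t) : BSig f nb mb :=
  C.encR1 s.val (fun u => relayRx1 n m h ⟨u.val, lt_trans u.isLt s.isLt⟩)

/-- Relay 2 transmitted signal `X_{R2}[s]`, a causal function of `Y_{R2}[1..s-1]`. -/
def relayTx2 (C : Code n m f nb mb N M1 M2) {t : ℕ}
    (h : Fin t → FSig n m × FSig n m) (s : Fin t) : BSig f nb mb :=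
  C.encR2 s.val (fun u => relayRx2 n m h ⟨u.val, lt_trans u.isLt s.isLt⟩)

/-- Source 1 overheard signal `Y_{S1}[s] = S^{q̄-n̄} X_{R1}[s] ⊕ S^{q̄-m̄} X_{R2}[s]`. -/
def srcRx1 (C : Code n m f nb mb N M1 M2) {t : ℕ}
    (h : Fin t → FSig n m × FSig n m) (s : Fin t) : BSig f nb mb :=
  (shiftMat (max mb (max nb f)) (max mb (max nb f) - nb)).mulVec (relayTx1 C h s) +
  (shiftMat (max mb (max nb f)) (max mb (max nb f) - mb)).mulVec (relayTx2 C h s)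

/-- Source 2 overheard signal `Y_{S2}[s] = S^{q̄-n̄} X_{R2}[s] ⊕ S^{q̄-m̄} X_{R1}[s]`. -/
def srcRx2 (C : Code n m f nb mb N M1 M2) {t : ℕ}
    (h : Fin t → FSig n m × FSig n m) (s : Fin t) : BSig f nb mb :=
  (shiftMat (max mb (max nb f)) (max mb (max nb f) - nb)).mulVec (relayTx2 C h s) +
  (shiftMat (max mb (max nb f)) (max mb (max nb f) - mb)).mulVec (relayTx1 C h s)

/-- The history `(X_{S1}[1..t], X_{S2}[1..t])` of source signals determined by the
messages `(w1, w2)`: at each time the sources apply their causal encoders to their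
message and the overheard signals so far. -/
def srcHist (C : Code n m f nb mb N M1 M2) (w1 : Fin M1) (w2 : Fin M2) :
    (t : ℕ) → Fin t → FSig n m × FSig n m
  | 0 => fun i => i.elim0
  | t + 1 =>
    Fin.snoc (srcHist C w1 w2 t)
      (C.encS1 t w1 (srcRx1 C (srcHist C w1 w2 t)),
       C.encS2 t w2 (srcRx2 C (srcHist C w1 w2 t)))

/-- `(X_{S1}[t], X_{S2}[t])`. -/
def srcXat (C : Code n m f nb mb N M1 M2) (w1 : Fin M1) (w2 : Fin M2) (t : ℕ) :
    FSig n m × FSig n m :=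
  srcHist C w1 w2 (t + 1) (Fin.last t)

/-- `Y_{R1}[t]`. -/
def relayRxAt1 (C : Code n m f nb mb N M1 M2) (w1 : Fin M1) (w2 : Fin M2) (t : ℕ) :
    FSig n m :=
  relayRx1 n m (srcHist C w1 w2 (t + 1)) (Fin.last t)

/-- `Y_{R2}[t]`. -/
def relayRxAt2 (C : Code n m f nb mb N M1 M2) (w1 : Fin M1) (w2 : Fin M2) (t : ℕ) :
    FSig n m :=
  relayRx2 n m (srcHist C w1 w2 (t + 1)) (Fin.last t)

/-- `X_{R1}[t]`. -/
def relayTxAt1 (C : Code n m f nb mb N M1 M2) (w1 : Fin M1) (w2 : Fin M2) (t : ℕ) :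
    BSig f nb mb :=
  relayTx1 C (srcHist C w1 w2 (t + 1)) (Fin.last t)

/-- `X_{R2}[t]`. -/
def relayTxAt2 (C : Code n m f nb mb N M1 M2) (w1 : Fin M1) (w2 : Fin M2) (t : ℕ) :
    BSig f nb mb :=
  relayTx2 C (srcHist C w1 w2 (t + 1)) (Fin.last t)

/-- `Y_{D1}[t] = S^{q̄-f} X_{R1}[t]`. -/
def destRx1 (C : Code n m f nb mb N M1 M2) (w1 : Fin M1) (w2 : Fin M2) (t : ℕ) :
    BSig f nb mb :=
  (shiftMat (max mb (max nb f)) (max mb (max nb f) - f)).mulVec (relayTxAt1 C w1 w2 t)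

/-- `Y_{D2}[t] = S^{q̄-f} X_{R2}[t]`. -/
def destRx2 (C : Code n m f nb mb N M1 M2) (w1 : Fin M1) (w2 : Fin M2) (t : ℕ) :
    BSig f nb mb :=
  (shiftMat (max mb (max nb f)) (max mb (max nb f) - f)).mulVec (relayTxAt2 C w1 w2 t)

/-- Probability of decoding error under independent uniform messages: since the channel is
deterministic, this is the fraction of message pairs `(w1, w2)` on which some decoder errs. -/
noncomputable def errProb (C : Code n m f nb mb N M1 M2) : ℝ :=
  ((Finset.univ.filter fun w : Fin M1 × Fin M2 =>
      C.dec1 (fun t => destRx1 C w.1 w.2 t.val) ≠ w.1 ∨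
      C.dec2 (fun t => destRx2 C w.1 w.2 t.val) ≠ w.2).card : ℝ) / ((M1 : ℝ) * (M2 : ℝ))

/-- A nonnegative rate pair `(R1, R2)` is achievable if for every `ε > 0` there is a
blocklength `N ≥ 1` and a code with message sets of sizes `⌈2^(N R1)⌉`, `⌈2^(N R2)⌉`
whose probability of error is at most `ε`. -/
def Achievable (n m f nb mb : ℕ) (R1 R2 : ℝ) : Prop :=
  0 ≤ R1 ∧ 0 ≤ R2 ∧
    ∀ ε : ℝ, 0 < ε →
      ∃ N : ℕ, 0 < N ∧
        ∃ C : Code n m f nb mb N ⌈(2 : ℝ) ^ ((N : ℝ) * R1)⌉₊ ⌈(2 : ℝ) ^ ((N : ℝ) * R2)⌉₊,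
          errProb C ≤ ε

/-- The sum capacity `C_sum = sup { R1 + R2 : (R1, R2) achievable }`. -/
noncomputable def sumCapacity (n m f nb mb : ℕ) : ℝ :=
  sSup {r : ℝ | ∃ R1 R2 : ℝ, Achievable n m f nb mb R1 R2 ∧ r = R1 + R2}

end TwoHopIC

namespace TwoHopIC

section FiberEntropy

variable {Ω α β γ : Type*} [Fintype Ω]

/-- The number of sample points at which `X` takes the value `x`. -/
noncomputable def valueCount (X : Ω → α) (x : α) : ℕ :=
  (Finset.univ.filter fun g => X g = x).card

/-- The sum over the sample space of the logarithms of the fiber sizes of `X`. For the uniform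
distribution, the entropy of `X` is `log |Ω| - fiberLog X / |Ω|`. -/
noncomputable def fiberLog (X : Ω → α) : ℝ :=
  ∑ g, Real.log (valueCount X (X g))

lemma valueCount_self_pos (X : Ω → α) (g : Ω) : 0 < valueCount X (X g) :=
  Finset.card_pos.2 ⟨g, by simp⟩

lemma fiberLog_le_of_determines {X : Ω → α} {Y : Ω → β}
    (h : ∀ g g', X g = X g' → Y g = Y g') : fiberLog X ≤ fiberLog Y := by
  refine Finset.sum_le_sum fun g _ => ?_
  have hle : valueCount X (X g) ≤ valueCount Y (Y g) := by
    refine Finset.card_le_card fun g' hg' => ?_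
    simp only [Finset.mem_filter, Finset.mem_univ, true_and] at hg' ⊢
    exact h _ _ hg'
  exact Real.log_le_log (by exact_mod_cast valueCount_self_pos X g) (by exact_mod_cast hle)

lemma fiberLog_eq_zero_of_injective {X : Ω → α} (h : Function.Injective X) : fiberLog X = 0 := by
  refine Finset.sum_eq_zero fun g _ => ?_
  have : valueCount X (X g) = 1 := by
    refine Finset.card_eq_one.2 ⟨g, ?_⟩
    ext g'
    simp [h.eq_iff]
  simp [this]

lemma sum_valueCount [Fintype α] (X : Ω → α) : ∑ x, valueCount X x = Fintype.card Ω := by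
  have := Finset.card_eq_sum_card_fiberwise (s := (Finset.univ : Finset Ω))
    (t := (Finset.univ : Finset α)) (f := X) (fun _ _ => by simp)
  simpa [valueCount, Finset.card_univ] using this.symm

lemma sum_valueCount_prod [Fintype α] (X : Ω → α) (Z : Ω → γ) (z : γ) :
    ∑ x, valueCount (fun g => (X g, Z g)) (x, z) = valueCount Z z := by
  have := Finset.card_eq_sum_card_fiberwise (s := Finset.univ.filter fun g => Z g = z)
    (t := (Finset.univ : Finset α)) (f := X) (fun _ _ => by simp)
  rw [valueCount, this]
  refine Finset.sum_congr rfl fun x _ => ?_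
  rw [valueCount]
  congr 1
  ext g
  simp [and_comm]

lemma sum_div_valueCount_le [Fintype α] (X : Ω → α) (φ : α → ℝ) (hφ : ∀ x, 0 ≤ φ x) :
    ∑ g, φ (X g) / valueCount X (X g) ≤ ∑ x, φ x := by
  rw [← Finset.sum_fiberwise (Finset.univ : Finset Ω) X]
  refine Finset.sum_le_sum fun x _ => ?_
  have : ∀ g ∈ Finset.univ.filter (fun g => X g = x),
      φ (X g) / valueCount X (X g) = φ x / valueCount X x := by
    intro g hg
    rw [(Finset.mem_filter.1 hg).2]
  rw [Finset.sum_congr rfl this, Finset.sum_const, nsmul_eq_mul]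
  change (valueCount X x : ℝ) * _ ≤ _
  rcases Nat.eq_zero_or_pos (valueCount X x) with h0 | h0
  · simp [h0, hφ x]
  · have : (valueCount X x : ℝ) ≠ 0 := by positivity
    rw [mul_div_cancel₀ _ this]

/-- Submodularity of entropy. -/
lemma fiberLog_submodular [Fintype α] [Fintype β] [Fintype γ]
    (X : Ω → α) (Y : Ω → β) (Z : Ω → γ) :
    fiberLog (fun g => (X g, Z g)) + fiberLog (fun g => (Y g, Z g)) ≤
      fiberLog (fun g => (X g, Y g, Z g)) + fiberLog Z := by
  let a : α → γ → ℝ := fun x z => valueCount (fun g => (X g, Z g)) (x, z)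
  let b : β → γ → ℝ := fun y z => valueCount (fun g => (Y g, Z g)) (y, z)
  let c : γ → ℝ := fun z => valueCount Z z
  let φ : α × β × γ → ℝ := fun p => a p.1 p.2.2 * b p.2.1 p.2.2 / c p.2.2
  have hφ : ∀ p, 0 ≤ φ p := fun p => by positivity
  have hsum : ∑ p, φ p ≤ Fintype.card Ω := by
    have hz : ∀ z, ∑ x, ∑ y, φ (x, y, z) ≤ c z := by
      intro z
      have h1 : ∑ x, a x z = c z := by
        simp only [a, c, ← sum_valueCount_prod X Z z]
        push_cast
        rfl
      have h2 : ∑ y, b y z = c z := by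
        simp only [b, c, ← sum_valueCount_prod Y Z z]
        push_cast
        rfl
      have : ∑ x, ∑ y, φ (x, y, z) = (∑ x, a x z) * (∑ y, b y z) / c z := by
        rw [Finset.sum_mul_sum, Finset.sum_div]
        refine Finset.sum_congr rfl fun x _ => ?_
        rw [Finset.sum_div]
      rw [this, h1, h2, mul_self_div_self]
    calc ∑ p, φ p = ∑ z, ∑ x, ∑ y, φ (x, y, z) := by
          simp only [Fintype.sum_prod_type]
          rw [Finset.sum_comm (s := (Finset.univ : Finset γ))]
          exact Finset.sum_congr rfl fun x _ => Finset.sum_comm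
      _ ≤ ∑ z, c z := Finset.sum_le_sum fun z _ => hz z
      _ = Fintype.card Ω := by
          simp only [c, ← sum_valueCount Z]
          push_cast
          rfl
  have hle := (sum_div_valueCount_le (fun g => (X g, Y g, Z g)) φ hφ).trans hsum
  have hpt : ∀ g, Real.log (valueCount (fun g => (X g, Z g)) (X g, Z g)) +
      Real.log (valueCount (fun g => (Y g, Z g)) (Y g, Z g)) ≤
      (Real.log (valueCount (fun g => (X g, Y g, Z g)) (X g, Y g, Z g)) +
        Real.log (valueCount Z (Z g))) +
      (φ (X g, Y g, Z g) / valueCount (fun g => (X g, Y g, Z g)) (X g, Y g, Z g) - 1) := by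
    intro g
    have p1 : (0 : ℝ) < valueCount (fun g => (X g, Z g)) (X g, Z g) := by
      exact_mod_cast valueCount_self_pos (fun g => (X g, Z g)) g
    have p2 : (0 : ℝ) < valueCount (fun g => (Y g, Z g)) (Y g, Z g) := by
      exact_mod_cast valueCount_self_pos (fun g => (Y g, Z g)) g
    have p3 : (0 : ℝ) < valueCount (fun g => (X g, Y g, Z g)) (X g, Y g, Z g) := by
      exact_mod_cast valueCount_self_pos (fun g => (X g, Y g, Z g)) g
    have p4 : (0 : ℝ) < valueCount Z (Z g) := by
      exact_mod_cast valueCount_self_pos Z g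
    have key := Real.log_le_sub_one_of_pos
      (x := φ (X g, Y g, Z g) / valueCount (fun g => (X g, Y g, Z g)) (X g, Y g, Z g))
      (by simp only [φ, a, b, c]; positivity)
    simp only [φ, a, b, c] at key ⊢
    rw [Real.log_div (by positivity) (by positivity), Real.log_div (by positivity) (by positivity),
      Real.log_mul (by positivity) (by positivity)] at key
    linarith
  have htot := Finset.sum_le_sum fun g (_ : g ∈ (Finset.univ : Finset Ω)) => hpt g
  simp only [Finset.sum_add_distrib, Finset.sum_sub_distrib, Finset.sum_const, Finset.card_univ,
    nsmul_eq_mul, mul_one] at htot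
  simp only [fiberLog]
  linarith

/-- Adjoining a variable with `k` values raises entropy by at most `log k`. -/
lemma fiberLog_le_add_card [Fintype α] [Fintype β] [Nonempty β] (V : Ω → α) (T : Ω → β) :
    fiberLog V ≤ fiberLog (fun g => (V g, T g)) +
      Fintype.card Ω * Real.log (Fintype.card β) := by
  have hK : (0 : ℝ) < Fintype.card β := by exact_mod_cast Fintype.card_pos
  let φ : α × β → ℝ := fun p => valueCount V p.1 / Fintype.card β
  have hsum : ∑ p, φ p = Fintype.card Ω := by
    simp only [φ, Fintype.sum_prod_type, Finset.sum_const, Finset.card_univ, nsmul_eq_mul]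
    rw [← sum_valueCount V]
    push_cast
    refine Finset.sum_congr rfl fun x _ => ?_
    field_simp
  have hle := sum_div_valueCount_le (fun g => (V g, T g)) φ fun p => by positivity
  rw [hsum] at hle
  have hpt : ∀ g, Real.log (valueCount V (V g)) ≤
      (Real.log (valueCount (fun g => (V g, T g)) (V g, T g)) + Real.log (Fintype.card β)) +
      (φ (V g, T g) / valueCount (fun g => (V g, T g)) (V g, T g) - 1) := by
    intro g
    have p1 : (0 : ℝ) < valueCount V (V g) := by exact_mod_cast valueCount_self_pos V g
    have p2 : (0 : ℝ) < valueCount (fun g => (V g, T g)) (V g, T g) := by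
      exact_mod_cast valueCount_self_pos (fun g => (V g, T g)) g
    have key := Real.log_le_sub_one_of_pos
      (x := φ (V g, T g) / valueCount (fun g => (V g, T g)) (V g, T g))
      (by simp only [φ]; positivity)
    simp only [φ] at key ⊢
    rw [Real.log_div (by positivity) (by positivity), Real.log_div (by positivity) (by positivity)]
      at key
    linarith
  have htot := Finset.sum_le_sum fun g (_ : g ∈ (Finset.univ : Finset Ω)) => hpt g
  simp only [Finset.sum_add_distrib, Finset.sum_sub_distrib, Finset.sum_const, Finset.card_univ,
    nsmul_eq_mul, mul_one] at htot
  simp only [fiberLog]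
  linarith

/-- A variable with `k` values has entropy at most `log k`. -/
lemma card_mul_log_le_fiberLog [Fintype β] [Nonempty β] (T : Ω → β) :
    Fintype.card Ω * Real.log (Fintype.card Ω) ≤
      fiberLog T + Fintype.card Ω * Real.log (Fintype.card β) := by
  have h1 := fiberLog_le_add_card (fun _ : Ω => ()) T
  have h2 : fiberLog (fun g => ((), T g)) ≤ fiberLog T :=
    fiberLog_le_of_determines fun g g' h => (Prod.ext_iff.1 h).2
  have h3 : fiberLog (fun _ : Ω => ()) = Fintype.card Ω * Real.log (Fintype.card Ω) := by
    simp [fiberLog, valueCount, Finset.card_univ]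
  linarith

end FiberEntropy

section Dynamics

lemma shiftMat_mulVec (q s : ℕ) (v : Fin q → ZMod 2) (i : Fin q) :
    (shiftMat q s).mulVec v i =
      if s ≤ i.val then v ⟨i.val - s, lt_of_le_of_lt (Nat.sub_le _ _) i.isLt⟩ else 0 := by
  simp only [Matrix.mulVec, dotProduct, shiftMat, Matrix.of_apply, ite_mul, one_mul, zero_mul]
  split_ifs with h
  · rw [Finset.sum_eq_single ⟨i.val - s, lt_of_le_of_lt (Nat.sub_le _ _) i.isLt⟩]
    · rw [if_pos]
      simp only
      omega
    · intro j _ hj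
      rw [if_neg]
      intro hij
      exact hj (Fin.ext (by simp only; omega))
    · simp
  · exact Finset.sum_eq_zero fun j _ => if_neg (by omega)

lemma shiftMat_mulVec_self (q : ℕ) (v : Fin q → ZMod 2) : (shiftMat q q).mulVec v = 0 := by
  ext i
  rw [shiftMat_mulVec, if_neg (by omega), Pi.zero_apply]

/-- The shift by `q - k` only depends on the top `k` entries. -/
lemma shiftMat_mulVec_congr {q k : ℕ} (hk : k ≤ q) {v v' : Fin q → ZMod 2}
    (h : ∀ j : Fin k, v (Fin.castLE hk j) = v' (Fin.castLE hk j)) :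
    (shiftMat q (q - k)).mulVec v = (shiftMat q (q - k)).mulVec v' := by
  ext i
  simp only [shiftMat_mulVec]
  split_ifs with hi
  · exact h ⟨i.val - (q - k), by omega⟩
  · rfl

/-- The shift by `q - k` reveals the top `k` entries. -/
lemma eq_of_shiftMat_mulVec_eq {q k : ℕ} (hk : k ≤ q) {v v' : Fin q → ZMod 2}
    (h : (shiftMat q (q - k)).mulVec v = (shiftMat q (q - k)).mulVec v') (j : Fin k) :
    v (Fin.castLE hk j) = v' (Fin.castLE hk j) := by
  have hj := congrFun h ⟨j.val + (q - k), by omega⟩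
  simp only [shiftMat_mulVec, Nat.le_add_left, if_true, Nat.add_sub_cancel] at hj
  exact hj

variable {n m f nb mb N M1 M2 : ℕ} (C : Code n m f nb mb N M1 M2) (w1 : Fin M1) (w2 : Fin M2)

lemma srcHist_apply (t : ℕ) (s : Fin t) : srcHist C w1 w2 t s = srcXat C w1 w2 s := by
  induction t with
  | zero => exact s.elim0
  | succ t ih =>
    refine Fin.lastCases ?_ (fun s => ?_) s
    · rfl
    · have : srcHist C w1 w2 (t + 1) s.castSucc = srcHist C w1 w2 t s := by
        simp only [srcHist, Fin.snoc_castSucc]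
      rw [this, ih]
      rfl

lemma relayRxAt1_eq (t : ℕ) : relayRxAt1 C w1 w2 t =
    (shiftMat (max m n) (max m n - n)).mulVec (srcXat C w1 w2 t).1 +
    (shiftMat (max m n) (max m n - m)).mulVec (srcXat C w1 w2 t).2 := rfl

lemma relayRxAt2_eq (t : ℕ) : relayRxAt2 C w1 w2 t =
    (shiftMat (max m n) (max m n - m)).mulVec (srcXat C w1 w2 t).1 +
    (shiftMat (max m n) (max m n - n)).mulVec (srcXat C w1 w2 t).2 := rfl

lemma relayTx1_srcHist (t : ℕ) (s : Fin t) : relayTx1 C (srcHist C w1 w2 t) s =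
    C.encR1 s (fun u => relayRxAt1 C w1 w2 u) := by
  simp only [relayTx1, relayRx1, relayRxAt1, srcHist_apply, Fin.val_last]

lemma relayTx2_srcHist (t : ℕ) (s : Fin t) : relayTx2 C (srcHist C w1 w2 t) s =
    C.encR2 s (fun u => relayRxAt2 C w1 w2 u) := by
  simp only [relayTx2, relayRx2, relayRxAt2, srcHist_apply, Fin.val_last]

lemma relayTxAt1_eq (t : ℕ) : relayTxAt1 C w1 w2 t =
    C.encR1 t (fun u => relayRxAt1 C w1 w2 u) :=
  relayTx1_srcHist C w1 w2 (t + 1) (Fin.last t)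

lemma relayTxAt2_eq (t : ℕ) : relayTxAt2 C w1 w2 t =
    C.encR2 t (fun u => relayRxAt2 C w1 w2 u) :=
  relayTx2_srcHist C w1 w2 (t + 1) (Fin.last t)

/-- `Y_{S1}[t]`. -/
def srcRxAt1 (t : ℕ) : BSig f nb mb :=
  (shiftMat (max mb (max nb f)) (max mb (max nb f) - nb)).mulVec (relayTxAt1 C w1 w2 t) +
  (shiftMat (max mb (max nb f)) (max mb (max nb f) - mb)).mulVec (relayTxAt2 C w1 w2 t)

/-- `Y_{S2}[t]`. -/
def srcRxAt2 (t : ℕ) : BSig f nb mb :=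
  (shiftMat (max mb (max nb f)) (max mb (max nb f) - nb)).mulVec (relayTxAt2 C w1 w2 t) +
  (shiftMat (max mb (max nb f)) (max mb (max nb f) - mb)).mulVec (relayTxAt1 C w1 w2 t)

lemma srcXat_eq (t : ℕ) : srcXat C w1 w2 t =
    (C.encS1 t w1 (fun s => srcRxAt1 C w1 w2 s), C.encS2 t w2 (fun s => srcRxAt2 C w1 w2 s)) := by
  have h1 : srcRx1 C (srcHist C w1 w2 t) = fun s : Fin t => srcRxAt1 C w1 w2 s := by
    ext1 s
    simp only [srcRx1, srcRxAt1, relayTx1_srcHist, relayTx2_srcHist, relayTxAt1_eq, relayTxAt2_eq]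
  have h2 : srcRx2 C (srcHist C w1 w2 t) = fun s : Fin t => srcRxAt2 C w1 w2 s := by
    ext1 s
    simp only [srcRx2, srcRxAt2, relayTx1_srcHist, relayTx2_srcHist, relayTxAt1_eq, relayTxAt2_eq]
  rw [srcXat, srcHist, Fin.snoc_last, h1, h2]

/-- The code with the roles of the two users exchanged. -/
def Code.swap : Code n m f nb mb N M2 M1 where
  encS1 := C.encS2
  encS2 := C.encS1
  encR1 := C.encR2
  encR2 := C.encR1
  dec1 := C.dec2
  dec2 := C.dec1

lemma srcXat_swap (t : ℕ) : srcXat C.swap w2 w1 t = (srcXat C w1 w2 t).swap := by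
  induction t using Nat.strong_induction_on with
  | _ t ih =>
    have hR1 : ∀ s < t, relayRxAt1 C.swap w2 w1 s = relayRxAt2 C w1 w2 s := by
      intro s hs
      rw [relayRxAt1_eq, relayRxAt2_eq, ih s hs, add_comm]
      rfl
    have hR2 : ∀ s < t, relayRxAt2 C.swap w2 w1 s = relayRxAt1 C w1 w2 s := by
      intro s hs
      rw [relayRxAt1_eq, relayRxAt2_eq, ih s hs, add_comm]
      rfl
    have hT1 : ∀ s < t, relayTxAt1 C.swap w2 w1 s = relayTxAt2 C w1 w2 s := by
      intro s hs
      rw [relayTxAt1_eq, relayTxAt2_eq]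
      exact congrArg (C.encR2 s) (funext fun u => hR1 u (u.isLt.trans hs))
    have hT2 : ∀ s < t, relayTxAt2 C.swap w2 w1 s = relayTxAt1 C w1 w2 s := by
      intro s hs
      rw [relayTxAt1_eq, relayTxAt2_eq]
      exact congrArg (C.encR1 s) (funext fun u => hR2 u (u.isLt.trans hs))
    rw [srcXat_eq, srcXat_eq]
    refine Prod.ext ?_ ?_
    · refine congrArg (C.encS2 t w2) (funext fun u => ?_)
      rw [srcRxAt1, srcRxAt2, hT1 u u.isLt, hT2 u u.isLt]
    · refine congrArg (C.encS1 t w1) (funext fun u => ?_)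
      rw [srcRxAt1, srcRxAt2, hT1 u u.isLt, hT2 u u.isLt]

lemma relayRxAt1_swap (t : ℕ) : relayRxAt1 C.swap w2 w1 t = relayRxAt2 C w1 w2 t := by
  rw [relayRxAt1_eq, relayRxAt2_eq, srcXat_swap, add_comm]
  rfl

lemma relayTxAt1_swap (t : ℕ) : relayTxAt1 C.swap w2 w1 t = relayTxAt2 C w1 w2 t := by
  rw [relayTxAt1_eq, relayTxAt2_eq]
  exact congrArg (C.encR2 t) (funext fun u => relayRxAt1_swap C w1 w2 u)

lemma destRx1_swap (t : ℕ) : destRx1 C.swap w2 w1 t = destRx2 C w1 w2 t := by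
  rw [destRx1, destRx2, relayTxAt1_swap]

lemma destRx2_swap (t : ℕ) : destRx2 C.swap w2 w1 t = destRx1 C w1 w2 t :=
  (destRx1_swap C.swap w2 w1 t).symm

end Dynamics

section Converse

variable {n m f nb mb N M1 M2 : ℕ}

/-- Both destinations decode the message pair `w` correctly. -/
def Decodes (C : Code n m f nb mb N M1 M2) (w : Fin M1 × Fin M2) : Prop :=
  C.dec1 (fun t => destRx1 C w.1 w.2 t.val) = w.1 ∧ C.dec2 (fun t => destRx2 C w.1 w.2 t.val) = w.2

lemma Decodes.swap {C : Code n m f nb mb N M1 M2} {w : Fin M1 × Fin M2} (h : Decodes C w) :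
    Decodes C.swap w.swap := by
  refine ⟨?_, ?_⟩
  · have := h.2
    simp only [← destRx1_swap C w.1 w.2] at this
    exact this
  · have := h.1
    simp only [← destRx2_swap C w.1 w.2] at this
    exact this

lemma one_sub_mul_le_card_decodes (C : Code n m f nb mb N M1 M2) (h1 : 0 < M1) (h2 : 0 < M2)
    {ε : ℝ} (hε : errProb C ≤ ε) :
    (1 - ε) * ((M1 : ℝ) * M2) ≤ Fintype.card {w // Decodes C w} := by
  have hpos : (0 : ℝ) < (M1 : ℝ) * M2 := by positivity
  rw [errProb, div_le_iff₀ hpos] at hε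
  have hcard := Finset.card_filter_add_card_filter_not
    (s := (Finset.univ : Finset (Fin M1 × Fin M2))) (p := fun w => Decodes C w)
  rw [Finset.card_univ, Fintype.card_prod, Fintype.card_fin, Fintype.card_fin] at hcard
  have hbad : (Finset.univ.filter fun w : Fin M1 × Fin M2 =>
      C.dec1 (fun t => destRx1 C w.1 w.2 t.val) ≠ w.1 ∨
      C.dec2 (fun t => destRx2 C w.1 w.2 t.val) ≠ w.2) =
      Finset.univ.filter fun w => ¬ Decodes C w :=
    Finset.filter_congr fun w _ => by rw [Decodes, not_and_or]
  rw [hbad] at hε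
  rw [Fintype.card_subtype]
  have : ((Finset.univ.filter fun w => Decodes C w).card : ℝ) +
      (Finset.univ.filter fun w => ¬ Decodes C w).card = M1 * M2 := by
    exact_mod_cast hcard
  linarith

lemma fst_eq_of_relayTx_eq {C : Code n m f nb mb N M1 M2} {w w' : Fin M1 × Fin M2}
    (hw : Decodes C w) (hw' : Decodes C w')
    (h : ∀ (t : Fin N) (j : Fin f),
      relayTxAt1 C w.1 w.2 t (Fin.castLE (by omega) j) =
        relayTxAt1 C w'.1 w'.2 t (Fin.castLE (by omega) j)) : w.1 = w'.1 := by
  rw [← hw.1, ← hw'.1]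
  exact congrArg C.dec1 (funext fun t => shiftMat_mulVec_congr (by omega) (h t))

lemma snd_eq_of_relayTx_eq {C : Code n m f nb mb N M1 M2} {w w' : Fin M1 × Fin M2}
    (hw : Decodes C w) (hw' : Decodes C w')
    (h : ∀ (t : Fin N) (j : Fin f),
      relayTxAt2 C w.1 w.2 t (Fin.castLE (by omega) j) =
        relayTxAt2 C w'.1 w'.2 t (Fin.castLE (by omega) j)) : w.2 = w'.2 :=
  fst_eq_of_relayTx_eq hw.swap hw'.swap fun t j => by
    simpa only [Prod.fst_swap, Prod.snd_swap, relayTxAt1_swap] using h t j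

lemma relayTxAt1_congr {C : Code n m f nb mb N M1 M2} {w w' : Fin M1 × Fin M2}
    (h : ∀ t < N, relayRxAt1 C w.1 w.2 t = relayRxAt1 C w'.1 w'.2 t) {t : ℕ} (ht : t < N) :
    relayTxAt1 C w.1 w.2 t = relayTxAt1 C w'.1 w'.2 t := by
  rw [relayTxAt1_eq, relayTxAt1_eq]
  exact congrArg (C.encR1 t) (funext fun u => h u (u.isLt.trans ht))

lemma relayTxAt2_congr {C : Code n m f nb mb N M1 M2} {w w' : Fin M1 × Fin M2}
    (h : ∀ t < N, relayRxAt2 C w.1 w.2 t = relayRxAt2 C w'.1 w'.2 t) {t : ℕ} (ht : t < N) :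
    relayTxAt2 C w.1 w.2 t = relayTxAt2 C w'.1 w'.2 t := by
  rw [relayTxAt2_eq, relayTxAt2_eq]
  exact congrArg (C.encR2 t) (funext fun u => h u (u.isLt.trans ht))

/-- The second hop carries at most `f` bits per user and channel use. -/
lemma card_decodes_le_secondHop (C : Code n m f nb mb N M1 M2) :
    Fintype.card {w // Decodes C w} ≤ 2 ^ (N * (2 * f)) := by
  let F : {w // Decodes C w} → (Fin N → Fin f → ZMod 2) × (Fin N → Fin f → ZMod 2) := fun w =>
    (fun t j => relayTxAt1 C w.1.1 w.1.2 t (Fin.castLE (by omega) j),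
      fun t j => relayTxAt2 C w.1.1 w.1.2 t (Fin.castLE (by omega) j))
  have hF : Function.Injective F := by
    intro w w' h
    simp only [F, Prod.mk.injEq] at h
    exact Subtype.ext (Prod.ext
      (fst_eq_of_relayTx_eq w.2 w'.2 fun t j => congrFun (congrFun h.1 t) j)
      (snd_eq_of_relayTx_eq w.2 w'.2 fun t j => congrFun (congrFun h.2 t) j))
  refine (Fintype.card_le_of_injective F hF).trans (le_of_eq ?_)
  simp only [Fintype.card_prod, Fintype.card_fun, Fintype.card_fin, ZMod.card]
  ring

/-- With direct-link overhearing only, a source signal is determined by the message and the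
overheard part of the signal of its own relay. -/
lemma srcXat_fst_congr {θ : ℕ} {C : Code n m f θ 0 N M1 M2} {w w' : Fin M1 × Fin M2}
    (hw : w.1 = w'.1)
    (h : ∀ (t : Fin N) (j : Fin θ),
      relayTxAt1 C w.1 w.2 t (Fin.castLE (by omega) j) =
        relayTxAt1 C w'.1 w'.2 t (Fin.castLE (by omega) j)) (t : Fin N) :
    (srcXat C w.1 w.2 t).1 = (srcXat C w'.1 w'.2 t).1 := by
  obtain ⟨w1, w2⟩ := w
  obtain ⟨w1', w2'⟩ := w'
  obtain rfl : w1 = w1' := hw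
  rw [srcXat_eq, srcXat_eq]
  refine congrArg (C.encS1 t w1) (funext fun u => ?_)
  simp only [srcRxAt1, Nat.sub_zero, shiftMat_mulVec_self, add_zero]
  exact shiftMat_mulVec_congr (by omega) (h ⟨u, u.isLt.trans t.isLt⟩)

lemma srcXat_snd_congr {θ : ℕ} {C : Code n m f θ 0 N M1 M2} {w w' : Fin M1 × Fin M2}
    (hw : w.2 = w'.2)
    (h : ∀ (t : Fin N) (j : Fin θ),
      relayTxAt2 C w.1 w.2 t (Fin.castLE (by omega) j) =
        relayTxAt2 C w'.1 w'.2 t (Fin.castLE (by omega) j)) (t : Fin N) :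
    (srcXat C w.1 w.2 t).2 = (srcXat C w'.1 w'.2 t).2 := by
  have := srcXat_fst_congr (C := C.swap) (w := w.swap) (w' := w'.swap) hw
    (fun t j => by simpa only [Prod.fst_swap, Prod.snd_swap, relayTxAt1_swap] using h t j) t
  simpa only [Prod.fst_swap, Prod.snd_swap, srcXat_swap] using this

/-- With direct-link overhearing only, the signal received by relay 1 reveals the message and the
signal of user 1, hence also the interfering part of the signal of user 2. -/
lemma eq_of_relayRxAt1_eq {θ : ℕ} {C : Code n m f θ 0 N M1 M2} {w w' : Fin M1 × Fin M2}
    (hw : Decodes C w) (hw' : Decodes C w')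
    (h : ∀ t < N, relayRxAt1 C w.1 w.2 t = relayRxAt1 C w'.1 w'.2 t) :
    w.1 = w'.1 ∧ ∀ t : Fin N, (srcXat C w.1 w.2 t).1 = (srcXat C w'.1 w'.2 t).1 ∧
      ∀ j : Fin m, (srcXat C w.1 w.2 t).2 (Fin.castLE (by omega) j) =
        (srcXat C w'.1 w'.2 t).2 (Fin.castLE (by omega) j) := by
  have h1 : w.1 = w'.1 := fst_eq_of_relayTx_eq hw hw' fun t j =>
    congrFun (relayTxAt1_congr h t.isLt) _
  refine ⟨h1, fun t => ?_⟩
  have hx := srcXat_fst_congr h1 (fun t j => congrFun (relayTxAt1_congr h t.isLt) _) t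
  refine ⟨hx, eq_of_shiftMat_mulVec_eq (by omega) ?_⟩
  have := h t t.isLt
  rw [relayRxAt1_eq, relayRxAt1_eq, hx] at this
  exact add_left_cancel this

/-- The sum-rate bound `2n - m`, valid even under unlimited feedback from the own relay. -/
lemma card_decodes_le_feedback {θ : ℕ} (hmn : m ≤ n) (C : Code n m f θ 0 N M1 M2) :
    Fintype.card {w // Decodes C w} ≤ 2 ^ (N * (2 * n - m)) := by
  let F : {w // Decodes C w} → (Fin N → FSig n m) × (Fin N → Fin (n - m) → ZMod 2) := fun w =>
    (fun t => relayRxAt1 C w.1.1 w.1.2 t,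
      fun t j => (srcXat C w.1.1 w.1.2 t).2 ⟨m + j, by omega⟩)
  have hF : Function.Injective F := by
    intro w w' h
    simp only [F, Prod.mk.injEq] at h
    obtain ⟨h1, hX⟩ := eq_of_relayRxAt1_eq w.2 w'.2 fun t ht => congrFun h.1 ⟨t, ht⟩
    have hX2 : ∀ t : Fin N, srcXat C w.1.1 w.1.2 t = srcXat C w'.1.1 w'.1.2 t := by
      intro t
      refine Prod.ext (hX t).1 (funext fun i => ?_)
      by_cases hi : i.val < m
      · exact (hX t).2 ⟨i, hi⟩
      · have := congrFun (congrFun h.2 t) ⟨i - m, by omega⟩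
        convert this using 2 <;> exact Fin.ext (by simp only; omega)
    have hY2 : ∀ t < N, relayRxAt2 C w.1.1 w.1.2 t = relayRxAt2 C w'.1.1 w'.1.2 t := by
      intro t ht
      rw [relayRxAt2_eq, relayRxAt2_eq, hX2 ⟨t, ht⟩]
    exact Subtype.ext (Prod.ext h1 (snd_eq_of_relayTx_eq w.2 w'.2 fun t j =>
      congrFun (relayTxAt2_congr hY2 t.isLt) _))
  refine (Fintype.card_le_of_injective F hF).trans (le_of_eq ?_)
  simp only [Fintype.card_prod, Fintype.card_fun, Fintype.card_fin, ZMod.card]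
  rw [← pow_mul, ← pow_mul, ← pow_add]
  congr 1
  rw [max_eq_right hmn, mul_comm n, mul_comm (n - m), ← Nat.mul_add]
  congr 1
  omega

/-- The part of the signals of source 1 that reaches relay 2. -/
def crossPart1 (C : Code n m f nb mb N M1 M2) (w : Fin M1 × Fin M2) : Fin N → Fin m → ZMod 2 :=
  fun t j => (srcXat C w.1 w.2 t).1 (Fin.castLE (by omega) j)

/-- The part of the signals of source 2 that reaches relay 1. -/
def crossPart2 (C : Code n m f nb mb N M1 M2) (w : Fin M1 × Fin M2) : Fin N → Fin m → ZMod 2 :=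
  fun t j => (srcXat C w.1 w.2 t).2 (Fin.castLE (by omega) j)

lemma crossPart1_swap (C : Code n m f nb mb N M1 M2) (w : Fin M1 × Fin M2) :
    crossPart1 C.swap w.swap = crossPart2 C w := by
  ext t j
  simp only [crossPart1, crossPart2, Prod.fst_swap, Prod.snd_swap, srcXat_swap]

lemma crossPart2_swap (C : Code n m f nb mb N M1 M2) (w : Fin M1 × Fin M2) :
    crossPart2 C.swap w.swap = crossPart1 C w := by
  ext t j
  simp only [crossPart1, crossPart2, Prod.fst_swap, Prod.snd_swap, srcXat_swap]

/-- The entropy inequality for user 1 behind the rate-limited feedback bound. -/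
lemma fiberLog_crossPart_le {θ : ℕ} (hmn : m ≤ n) (hM2 : 0 < M2) (C : Code n m f θ 0 N M1 M2)
    {Ω : Type*} [Fintype Ω] (p : Ω → Fin M1 × Fin M2) (hp : Function.Injective p)
    (hdec : ∀ g, Decodes C (p g)) :
    fiberLog (fun g => crossPart1 C (p g)) + Fintype.card Ω * Real.log (Fintype.card Ω) ≤
      fiberLog (fun g => crossPart2 C (p g)) + Fintype.card Ω *
        (Real.log M2 + N * ((max m (n - m) : ℕ) + θ : ℝ) * Real.log 2) := by
  have hq : max m n = n := max_eq_right hmn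
  have : Nonempty (Fin M2) := ⟨⟨0, hM2⟩⟩
  let V1 : Ω → Fin N → Fin m → ZMod 2 := fun g => crossPart1 C (p g)
  let V2 : Ω → Fin N → Fin m → ZMod 2 := fun g => crossPart2 C (p g)
  let W1 : Ω → Fin M1 := fun g => (p g).1
  let Y1 : Ω → Fin N → FSig n m := fun g t => relayRxAt1 C (p g).1 (p g).2 t
  let T : Ω → Fin N → Fin (max m (n - m)) → ZMod 2 :=
    fun g t j => relayRxAt1 C (p g).1 (p g).2 t ⟨n - max m (n - m) + j, by omega⟩
  let WF : Ω → Fin M2 × (Fin N → Fin θ → ZMod 2) :=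
    fun g => ((p g).2, fun t j => relayTxAt2 C (p g).1 (p g).2 t (Fin.castLE (by omega) j))
  have hsub := fiberLog_submodular W1 WF V2
  have hall : fiberLog (fun g => (W1 g, WF g, V2 g)) = 0 := by
    refine fiberLog_eq_zero_of_injective fun g g' h => hp ?_
    simp only [W1, WF, Prod.mk.injEq] at h
    exact Prod.ext h.1 h.2.1.1
  have hY1 : fiberLog Y1 ≤ fiberLog (fun g => (W1 g, V2 g)) := by
    refine fiberLog_le_of_determines fun g g' h => ?_
    obtain ⟨h1, hX⟩ := eq_of_relayRxAt1_eq (hdec g) (hdec g') fun t ht => congrFun h ⟨t, ht⟩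
    exact Prod.ext h1 (funext fun t => funext fun j => (hX t).2 j)
  have hVT : fiberLog (fun g => (V1 g, T g)) ≤ fiberLog Y1 := by
    refine fiberLog_le_of_determines fun g g' h => ?_
    simp only [Prod.mk.injEq] at h
    refine funext fun t => funext fun i => ?_
    by_cases hi : i.val < n - max m (n - m)
    · have hclean : ∀ w : Fin M1 × Fin M2, relayRxAt1 C w.1 w.2 t i = (srcXat C w.1 w.2 t).1 i := by
        intro w
        rw [relayRxAt1_eq, Pi.add_apply, shiftMat_mulVec, shiftMat_mulVec, if_pos (by omega),
          if_neg (by omega), add_zero]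
        exact congrArg _ (Fin.ext (by simp only; omega))
      simp only [Y1, hclean]
      exact congrFun (congrFun h.1 t) ⟨i, by omega⟩
    · have := congrFun (congrFun h.2 t) ⟨i - (n - max m (n - m)), by omega⟩
      simp only [T] at this
      convert this using 2 <;> exact Fin.ext (by simp only; omega)
  have hWF : fiberLog WF ≤ fiberLog (fun g => (WF g, V2 g)) := by
    refine fiberLog_le_of_determines fun g g' h => Prod.ext h ?_
    simp only [WF, Prod.mk.injEq] at h
    exact funext fun t => funext fun j => congrFun
      (srcXat_snd_congr h.1 (fun t j => congrFun (congrFun h.2 t) j) t) _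
  have hT := fiberLog_le_add_card V1 T
  have hcard := card_mul_log_le_fiberLog WF
  simp only [Fintype.card_prod, Fintype.card_fun, Fintype.card_fin, ZMod.card, Nat.cast_mul,
    Nat.cast_pow, Nat.cast_ofNat, Real.log_pow] at hT hcard
  rw [Real.log_mul (by positivity) (by positivity), Real.log_pow, Real.log_pow] at hcard
  rw [hall, zero_add] at hsub
  change fiberLog V1 + _ ≤ fiberLog V2 + _
  linarith

/-- The sum-rate bound `2 max(m, n - m) + 2θ` under direct-link overhearing. -/
lemma log_card_decodes_le {θ : ℕ} (hmn : m ≤ n) (hM1 : 0 < M1) (hM2 : 0 < M2)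
    (C : Code n m f θ 0 N M1 M2) (hpos : 0 < Fintype.card {w // Decodes C w}) :
    2 * Real.log (Fintype.card {w // Decodes C w}) ≤ Real.log M1 + Real.log M2 +
      2 * (N * ((max m (n - m) : ℕ) + θ : ℝ) * Real.log 2) := by
  have h1 := fiberLog_crossPart_le hmn hM2 C (Subtype.val : {w // Decodes C w} → _)
    Subtype.val_injective fun g => g.2
  have h2 := fiberLog_crossPart_le hmn hM1 C.swap
    (fun g : {w // Decodes C w} => g.1.swap)
    (Prod.swap_injective.comp Subtype.val_injective) fun g => g.2.swap
  simp only [crossPart1_swap, crossPart2_swap] at h2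
  have hc : (0 : ℝ) < Fintype.card {w // Decodes C w} := by exact_mod_cast hpos
  refine le_of_mul_le_mul_left ?_ hc
  linarith

lemma ceil_rpow_pos (x : ℝ) : 0 < ⌈(2 : ℝ) ^ x⌉₊ := Nat.ceil_pos.2 (by positivity)

lemma mul_log_two_le_log_ceil (x : ℝ) : x * Real.log 2 ≤ Real.log (⌈(2 : ℝ) ^ x⌉₊ : ℕ) := by
  rw [← Real.log_rpow two_pos]
  exact Real.log_le_log (by positivity) (Nat.le_ceil _)

/-- A bound on the number of decodable message pairs, up to a factor that tends to `1` with the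
number of wrongly decoded pairs, bounds the sum rate. -/
lemma Achievable.add_le {R1 R2 K : ℝ} (h : Achievable n m f nb mb R1 R2)
    (hK : ∀ (N M1 M2 : ℕ), 0 < M1 → 0 < M2 → ∀ C : Code n m f nb mb N M1 M2,
      0 < Fintype.card {w // Decodes C w} →
      2 * Real.log (Fintype.card {w // Decodes C w}) ≤
        Real.log M1 + Real.log M2 + N * K * Real.log 2) : R1 + R2 ≤ K := by
  by_contra! hlt
  let δ : ℝ := (R1 + R2 - K) * Real.log 2
  have hδ : 0 < δ := mul_pos (by linarith) (Real.log_pos one_lt_two)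
  have hε : 0 < 1 - Real.exp (-δ / 4) := by
    have : Real.exp (-δ / 4) < 1 := by
      rw [← Real.exp_zero]
      exact Real.exp_lt_exp.2 (by linarith)
    linarith
  obtain ⟨N, hN, C, hC⟩ := h.2.2 _ hε
  have p1 := ceil_rpow_pos (N * R1)
  have p2 := ceil_rpow_pos (N * R2)
  have hcard := one_sub_mul_le_card_decodes C p1 p2 hC
  rw [sub_sub_cancel] at hcard
  have l1 := mul_log_two_le_log_ceil (N * R1)
  have l2 := mul_log_two_le_log_ceil (N * R2)
  have hpos : (0 : ℝ) < Fintype.card {w // Decodes C w} := lt_of_lt_of_le (by positivity) hcard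
  have hb := hK N _ _ p1 p2 C (by exact_mod_cast hpos)
  have hlog := Real.log_le_log (by positivity) hcard
  rw [Real.log_mul (by positivity) (by positivity), Real.log_exp,
    Real.log_mul (by positivity) (by positivity)] at hlog
  have hN1 : (1 : ℝ) ≤ N := by exact_mod_cast hN
  have : δ ≤ N * δ := le_mul_of_one_le_left hδ.le hN1
  have h4 : N * δ = N * R1 * Real.log 2 + N * R2 * Real.log 2 - N * K * Real.log 2 := by
    simp only [δ]
    ring
  linarith

lemma Achievable.add_le_of_card_le {R1 R2 : ℝ} {K : ℕ} (h : Achievable n m f nb mb R1 R2)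
    (hK : ∀ (N M1 M2 : ℕ) (C : Code n m f nb mb N M1 M2),
      Fintype.card {w // Decodes C w} ≤ 2 ^ (N * K)) : R1 + R2 ≤ K := by
  refine h.add_le fun N M1 M2 h1 h2 C hpos => ?_
  have hc : (0 : ℝ) < Fintype.card {w // Decodes C w} := by exact_mod_cast hpos
  have hle : Real.log (Fintype.card {w // Decodes C w}) ≤ N * K * Real.log 2 := by
    have := Real.log_le_log hc (by exact_mod_cast hK N M1 M2 C :
      (Fintype.card {w // Decodes C w} : ℝ) ≤ (2 : ℝ) ^ (N * K))
    rwa [Real.log_pow, Nat.cast_mul] at this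
  have hle' : Real.log (Fintype.card {w // Decodes C w}) ≤ Real.log M1 + Real.log M2 := by
    rw [← Real.log_mul (by positivity) (by positivity)]
    refine Real.log_le_log hc ?_
    have := Fintype.card_subtype_le (fun w => Decodes C w)
    rw [Fintype.card_prod, Fintype.card_fin, Fintype.card_fin] at this
    exact_mod_cast this
  linarith

/-- Under direct-link overhearing, the sum rate is at most
`min(2f, 2n - m, 2 max(m, n - m) + 2θ)`. -/
lemma Achievable.add_le_direct {θ : ℕ} {R1 R2 : ℝ} (hmn : m ≤ n)
    (h : Achievable n m f θ 0 R1 R2) :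
    R1 + R2 ≤ (min (2 * f) (min (2 * n - m) (2 * max m (n - m) + 2 * θ)) : ℕ) := by
  have hA := h.add_le_of_card_le fun N M1 M2 C => card_decodes_le_secondHop C
  have hB := h.add_le_of_card_le fun N M1 M2 C => card_decodes_le_feedback hmn C
  have hC : R1 + R2 ≤ ((2 * max m (n - m) + 2 * θ : ℕ) : ℝ) := by
    refine h.add_le fun N M1 M2 h1 h2 C hpos => ?_
    refine (log_card_decodes_le hmn h1 h2 C hpos).trans (le_of_eq ?_)
    push_cast
    ring
  rw [Nat.cast_min, Nat.cast_min]
  exact le_min hA (le_min hB hC)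

end Converse

section Achievability

/-- Entry `l` of a vector, with the value `0` outside the index range. -/
def coord {q : ℕ} (v : Fin q → ZMod 2) (l : ℕ) : ZMod 2 :=
  if h : l < q then v ⟨l, h⟩ else 0

/-- Entry `s` of a finite history, with the value `0` outside the index range. -/
def past {t q : ℕ} (h : Fin t → Fin q → ZMod 2) (s : ℕ) : Fin q → ZMod 2 :=
  if hs : s < t then h ⟨s, hs⟩ else 0

lemma coord_of_lt {q : ℕ} (v : Fin q → ZMod 2) {l : ℕ} (h : l < q) : coord v l = v ⟨l, h⟩ :=
  dif_pos h

lemma past_of_lt {t q : ℕ} (h : Fin t → Fin q → ZMod 2) {s : ℕ} (hs : s < t) :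
    past h s = h ⟨s, hs⟩ :=
  dif_pos hs

/-- The signal of a source with bits `U`, where `V` are the bits of the other user. Time is divided
into pairs of slots; pair `g` carries the bits `U g J`. Bits with `J < k` occupy the levels from
`2m - n` on in the even slot, and are repeated by the other user in the odd slot two pairs later.
The other bits occupy the levels below `2m - n` and the levels from `m` on in both slots. -/
def sourceSignal (n m k : ℕ) (U V : ℕ → ℕ → ZMod 2) (t l : ℕ) : ZMod 2 :=
  if l < 2 * m - n then U (t / 2) (k + (2 * l + t % 2))
  else if l < 2 * m - n + k then
    if t % 2 = 0 then U (t / 2) (l - (2 * m - n)) else V (t / 2 - 2) (l - (2 * m - n))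
  else if l < m then 0
  else U (t / 2) (k + (2 * (l - m + (2 * m - n)) + t % 2))

/-- The signal received by the relay of the user with bits `U`. -/
def relaySignal (n m k : ℕ) (U V : ℕ → ℕ → ZMod 2) (t l : ℕ) : ZMod 2 :=
  sourceSignal n m k U V t l +
    if n - m ≤ l then sourceSignal n m k V U t (l - (n - m)) else 0

/-- The slot in which a source sends what the other one sends in slot `t` on the repeated
levels. -/
def partnerSlot (t : ℕ) : ℕ := if t % 2 = 0 then t + 5 else 2 * (t / 2 - 2)

/-- The relay's estimate of its user's bit `J` of pair `g`, for `J ≥ k`: interference on the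
repeated levels is removed with the help of the partner slot. -/
def relayReadLate (n m k : ℕ) (Y : ℕ → ℕ → ZMod 2) (g J : ℕ) : ZMod 2 :=
  if (J - k) / 2 < 2 * m - n then Y (2 * g + (J - k) % 2) ((J - k) / 2)
  else
    Y (2 * g + (J - k) % 2) (m + (J - k) / 2 - (2 * m - n)) -
      if n - m + (2 * m - n) ≤ m + (J - k) / 2 - (2 * m - n) ∧
          m + (J - k) / 2 - (2 * m - n) < n - m + (2 * m - n) + k then
        Y (partnerSlot (2 * g + (J - k) % 2)) (m + (J - k) / 2 - (2 * m - n) - (n - m))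
      else 0

/-- The bit with index `J` that a relay sends in pair `p`. -/
def relayRead (n m k : ℕ) (Y : ℕ → ℕ → ZMod 2) (p J : ℕ) : ZMod 2 :=
  if J < k then Y (2 * (p - 1)) (2 * m - n + J) else relayReadLate n m k Y (p - 3) J

variable {n m k : ℕ}

lemma relaySignal_of_lt (U V : ℕ → ℕ → ZMod 2) (t : ℕ) {l : ℕ} (hl : l < n - m) :
    relaySignal n m k U V t l = sourceSignal n m k U V t l := by
  rw [relaySignal, if_neg (by omega), add_zero]

lemma sourceSignal_partnerSlot (U V : ℕ → ℕ → ZMod 2) (t : ℕ) {l : ℕ} (h1 : 2 * m - n ≤ l)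
    (h2 : l < 2 * m - n + k) :
    sourceSignal n m k U V (partnerSlot t) l = sourceSignal n m k V U t l := by
  simp only [sourceSignal, if_neg (not_lt.2 h1), if_pos h2, partnerSlot]
  rcases Nat.mod_two_eq_zero_or_one t with ht | ht
  · have e1 : (t + 5) % 2 = 1 := by omega
    have e2 : (t + 5) / 2 - 2 = t / 2 := by omega
    simp [ht, e1, e2]
  · have e2 : 2 * (t / 2 - 2) / 2 = t / 2 - 2 := by omega
    simp [ht, e2]

lemma relayReadLate_relaySignal (h : 3 * m ≤ 2 * n) (hk : 2 * m - n + k ≤ min m (n - m))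
    (U V : ℕ → ℕ → ZMod 2) (g : ℕ) {J : ℕ} (hkJ : k ≤ J) (hJ : J < k + 2 * max m (n - m)) :
    relayReadLate n m k (relaySignal n m k U V) g J = U g J := by
  obtain ⟨i, rfl⟩ := Nat.exists_eq_add_of_le hkJ
  have hdiv : (2 * g + i % 2) / 2 = g := by omega
  have hmod : (2 * g + i % 2) % 2 = i % 2 := by omega
  rw [relayReadLate, Nat.add_sub_cancel_left]
  split_ifs with hc hint
  · rw [relaySignal_of_lt _ _ _ (by omega), sourceSignal, if_pos hc, hdiv, hmod]
    congr 2
    omega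
  · rw [relaySignal_of_lt (l := m + i / 2 - (2 * m - n) - (n - m)) _ _ _ (by omega),
      sourceSignal_partnerSlot _ _ _ (by omega) (by omega), relaySignal, if_pos (by omega),
      add_sub_cancel_right, sourceSignal, if_neg (by omega), if_neg (by omega), if_neg (by omega),
      hdiv, hmod]
    congr 2
    omega
  · have hz : (if n - m ≤ m + i / 2 - (2 * m - n) then sourceSignal n m k V U (2 * g + i % 2)
        (m + i / 2 - (2 * m - n) - (n - m)) else 0) = 0 := by
      split_ifs with hn
      · rw [sourceSignal, if_neg (by omega), if_neg (by omega), if_pos (by omega)]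
      · rfl
    rw [relaySignal, hz, sub_zero, add_zero, sourceSignal, if_neg (by omega), if_neg (by omega),
      if_neg (by omega), hdiv, hmod]
    congr 2
    omega

lemma relayRead_relaySignal (h : 3 * m ≤ 2 * n) (hk : 2 * m - n + k ≤ min m (n - m))
    (U V : ℕ → ℕ → ZMod 2) (p : ℕ) {J : ℕ} (hJ : J < k + 2 * max m (n - m)) :
    relayRead n m k (relaySignal n m k U V) p J = U (if J < k then p - 1 else p - 3) J := by
  rw [relayRead]
  split_ifs with hJk
  · rw [relaySignal_of_lt _ _ _ (by omega), sourceSignal, if_neg (by omega), if_pos (by omega),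
      if_pos (by omega)]
    congr 1 <;> omega
  · exact relayReadLate_relaySignal h hk U V _ (by omega) hJ

lemma relayRead_congr (h : 3 * m ≤ 2 * n) (hk : 2 * m - n + k ≤ min m (n - m))
    {Y Y' : ℕ → ℕ → ZMod 2} {p : ℕ} (hp : 3 ≤ p)
    (hY : ∀ s < 2 * p, ∀ l < n, Y s l = Y' s l) {J : ℕ} (hJ : J < k + 2 * max m (n - m)) :
    relayRead n m k Y p J = relayRead n m k Y' p J := by
  have hpart : partnerSlot (2 * (p - 3) + (J - k) % 2) < 2 * p := by
    rw [partnerSlot]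
    split_ifs <;> omega
  simp only [relayRead, relayReadLate]
  split_ifs with h1 h2 h3
  · exact hY _ (by omega) _ (by omega)
  · exact hY _ (by omega) _ (by omega)
  · rw [hY _ (by omega) _ (by omega), hY _ hpart _ (by omega)]
  · rw [hY _ (by omega) _ (by omega)]

/-- Relay encoder of the pipelined scheme. -/
def relayEncoder (n m f θ k : ℕ) (t : ℕ) (h : Fin t → FSig n m) : BSig f 0 θ := fun i =>
  if t < 6 then 0 else relayRead n m k (fun s l => coord (past h s) l) (t / 2) (2 * i + t % 2)

/-- Source encoder of the pipelined scheme, for messages represented by the bits `bits w`. -/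
def sourceEncoder (n m f θ k : ℕ) {M : ℕ} (bits : Fin M → ℕ → ℕ → ZMod 2) (t : ℕ) (w : Fin M)
    (h : Fin t → BSig f 0 θ) : FSig n m := fun l =>
  sourceSignal n m k (bits w)
    (fun g j => if g < 3 then 0 else
      coord (past h (2 * (g + 1) + j % 2)) (max θ (max 0 f) - θ + j / 2)) t l

/-- The destination's estimate of the message bits, supported in the pairs `3, …, G + 2` and in
the indices below `K`. -/
def destRead (f θ k K G : ℕ) {N : ℕ} (y : Fin N → BSig f 0 θ) (g J : ℕ) : ZMod 2 :=
  if 3 ≤ g ∧ g < G + 3 ∧ J < K then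
    coord (past y (2 * (if J < k then g + 1 else g + 3) + J % 2)) (max θ (max 0 f) - f + J / 2)
  else 0

/-- The pipelined scheme for cross-link overhearing. -/
noncomputable def pipelinedCode (n m f θ k K G : ℕ) {M : ℕ} [Nonempty (Fin M)]
    (bits : Fin M → ℕ → ℕ → ZMod 2) : Code n m f 0 θ (2 * (G + 6)) M M where
  encS1 := sourceEncoder n m f θ k bits
  encS2 := sourceEncoder n m f θ k bits
  encR1 := relayEncoder n m f θ k
  encR2 := relayEncoder n m f θ k
  dec1 := fun y => Function.invFun bits (destRead f θ k K G y)
  dec2 := fun y => Function.invFun bits (destRead f θ k K G y)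

lemma relayEncoder_apply (h : 3 * m ≤ 2 * n) (hk : 2 * m - n + k ≤ min m (n - m)) {f θ : ℕ}
    (U V : ℕ → ℕ → ZMod 2) {t : ℕ} (ht : 6 ≤ t) (y : Fin t → FSig n m)
    (hy : ∀ s l, y s l = relaySignal n m k U V s l) (i : Fin (max θ (max 0 f)))
    (hi : 2 * i.val + t % 2 < k + 2 * max m (n - m)) :
    relayEncoder n m f θ k t y i =
      U (if 2 * i.val + t % 2 < k then t / 2 - 1 else t / 2 - 3) (2 * i + t % 2) := by
  rw [relayEncoder, if_neg (by omega), ← relayRead_relaySignal h hk U V (t / 2) hi]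
  refine relayRead_congr h hk (by omega) (fun s hs l hl => ?_) hi
  rw [past_of_lt y (show s < t by omega), coord_of_lt _ (show l < max m n by omega), hy]

lemma sourceEncoder_apply {f θ M : ℕ} (hkθ : k ≤ 2 * θ)
    (bits : Fin M → ℕ → ℕ → ZMod 2) (V : ℕ → ℕ → ZMod 2) (hV : ∀ g < 3, ∀ J, V g J = 0)
    {t : ℕ} (w : Fin M) (y : Fin t → BSig f 0 θ)
    (hy : ∀ s : Fin t, 6 ≤ s.val → ∀ i : Fin θ, 2 * i.val + s % 2 < k →
      y s ⟨max θ (max 0 f) - θ + i, by omega⟩ = V (s / 2 - 1) (2 * i + s % 2))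
    (l : Fin (max m n)) :
    sourceEncoder n m f θ k bits t w y l = sourceSignal n m k (bits w) V t l := by
  simp only [sourceEncoder, sourceSignal]
  split_ifs with h1 h2 h3 h4 h5 <;> try rfl
  · exact (hV _ h4 _).symm
  · have hs : 2 * (t / 2 - 2 + 1) + (l.val - (2 * m - n)) % 2 < t := by omega
    rw [past_of_lt y hs, coord_of_lt _ (by omega)]
    have := hy ⟨_, hs⟩ (by simp only; omega) ⟨(l.val - (2 * m - n)) / 2, by omega⟩
      (by simp only; omega)
    refine this.trans ?_
    congr 1 <;> simp only <;> omega

section Scheme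

variable {f θ K G M : ℕ} [Nonempty (Fin M)] (bits : Fin M → ℕ → ℕ → ZMod 2)

lemma relaySignal_eq_received (h : 3 * m ≤ 2 * n) (U V : ℕ → ℕ → ZMod 2) (t : ℕ)
    (l : Fin (max m n)) :
    ((shiftMat (max m n) (max m n - n)).mulVec (fun l => sourceSignal n m k U V t l) +
      (shiftMat (max m n) (max m n - m)).mulVec (fun l => sourceSignal n m k V U t l)) l =
    relaySignal n m k U V t l := by
  have hq : max m n = n := max_eq_right (by omega)
  rw [Pi.add_apply, shiftMat_mulVec, shiftMat_mulVec, relaySignal, if_pos (by omega)]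
  simp only [hq, Nat.sub_self, Nat.sub_zero]

variable (K G) in
lemma srcXat_pipelinedCode (h : 3 * m ≤ 2 * n) (hk : 2 * m - n + k ≤ min m (n - m))
    (hkθ : k ≤ 2 * θ) (hbits : ∀ w, ∀ g < 3, ∀ J, bits w g J = 0) (w1 w2 : Fin M) (t : ℕ) :
    srcXat (pipelinedCode n m f θ k K G bits) w1 w2 t =
      (fun l : Fin (max m n) => sourceSignal n m k (bits w1) (bits w2) t l,
        fun l : Fin (max m n) => sourceSignal n m k (bits w2) (bits w1) t l) := by
  induction t using Nat.strong_induction_on with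
  | _ t ih =>
    have hR1 : ∀ s < t, ∀ l, relayRxAt1 (pipelinedCode n m f θ k K G bits) w1 w2 s l =
        relaySignal n m k (bits w1) (bits w2) s l := by
      intro s hs l
      rw [relayRxAt1_eq, ih s hs]
      exact relaySignal_eq_received h _ _ s l
    have hR2 : ∀ s < t, ∀ l, relayRxAt2 (pipelinedCode n m f θ k K G bits) w1 w2 s l =
        relaySignal n m k (bits w2) (bits w1) s l := by
      intro s hs l
      rw [relayRxAt2_eq, ih s hs, add_comm]
      exact relaySignal_eq_received h _ _ s l
    rw [srcXat_eq]
    refine Prod.ext (funext fun l => ?_) (funext fun l => ?_)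
    · refine sourceEncoder_apply hkθ bits (bits w2) (hbits w2) w1 _ (fun s hs i hi => ?_) l
      simp only [srcRxAt1, Nat.sub_zero, shiftMat_mulVec_self, zero_add]
      rw [shiftMat_mulVec, if_pos (by simp only; omega), relayTxAt2_eq]
      refine (relayEncoder_apply h hk (bits w2) (bits w1) hs _
        (fun u l => hR2 u (u.isLt.trans s.isLt) l) _ (by simp only; omega)).trans ?_
      simp only [Nat.add_sub_cancel_left, if_pos hi]
    · refine sourceEncoder_apply hkθ bits (bits w1) (hbits w1) w2 _ (fun s hs i hi => ?_) l
      simp only [srcRxAt2, Nat.sub_zero, shiftMat_mulVec_self, zero_add]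
      rw [shiftMat_mulVec, if_pos (by simp only; omega), relayTxAt1_eq]
      refine (relayEncoder_apply h hk (bits w1) (bits w2) hs _
        (fun u l => hR1 u (u.isLt.trans s.isLt) l) _ (by simp only; omega)).trans ?_
      simp only [Nat.add_sub_cancel_left, if_pos hi]

lemma destRead_eq (h : 3 * m ≤ 2 * n) (hk : 2 * m - n + k ≤ min m (n - m))
    (hK : K ≤ k + 2 * max m (n - m)) (hKf : K ≤ 2 * f) (U V : ℕ → ℕ → ZMod 2)
    (hU : ∀ g J, ¬ (3 ≤ g ∧ g < G + 3 ∧ J < K) → U g J = 0) (y : ℕ → FSig n m)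
    (hy : ∀ s l, y s l = relaySignal n m k U V s l) :
    destRead f θ k K G (fun t : Fin (2 * (G + 6)) =>
      (shiftMat (max θ (max 0 f)) (max θ (max 0 f) - f)).mulVec
        (relayEncoder n m f θ k t fun u => y u)) = U := by
  ext g J
  rw [destRead]
  split_ifs with hg hJ
  · rw [past_of_lt _ (by omega), coord_of_lt _ (by omega), shiftMat_mulVec,
      if_pos (by simp only; omega), relayEncoder_apply h hk U V (by simp only; omega) _
        (fun s l => hy s l) _ (by simp only; omega)]
    rw [if_pos (by simp only; omega)]
    congr 1 <;> simp only <;> omega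
  · rw [past_of_lt _ (by omega), coord_of_lt _ (by omega), shiftMat_mulVec,
      if_pos (by simp only; omega), relayEncoder_apply h hk U V (by simp only; omega) _
        (fun s l => hy s l) _ (by simp only; omega)]
    rw [if_neg (by simp only; omega)]
    congr 1 <;> simp only <;> omega
  · exact (hU g J hg).symm

lemma errProb_pipelinedCode (h : 3 * m ≤ 2 * n) (hk : 2 * m - n + k ≤ min m (n - m))
    (hkθ : k ≤ 2 * θ) (hK : K ≤ k + 2 * max m (n - m)) (hKf : K ≤ 2 * f)
    (hinj : Function.Injective bits)
    (hbits : ∀ w g J, ¬ (3 ≤ g ∧ g < G + 3 ∧ J < K) → bits w g J = 0) :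
    errProb (pipelinedCode n m f θ k K G bits) = 0 := by
  have hX := srcXat_pipelinedCode (f := f) K G bits h hk hkθ
    fun w g hg J => hbits w g J fun hgJ => by omega
  rw [errProb, Finset.filter_eq_empty_iff.2, Finset.card_empty, Nat.cast_zero, zero_div]
  rintro ⟨w1, w2⟩ -
  rw [not_or, not_not, not_not]
  constructor
  · have hread : destRead f θ k K G (fun t : Fin (2 * (G + 6)) =>
        destRx1 (pipelinedCode n m f θ k K G bits) w1 w2 t) = bits w1 := by
      simp only [destRx1, relayTxAt1_eq]
      refine destRead_eq h hk hK hKf (bits w1) (bits w2) (hbits w1)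
        (relayRxAt1 (pipelinedCode n m f θ k K G bits) w1 w2) fun s l => ?_
      rw [relayRxAt1_eq, hX]
      exact relaySignal_eq_received h _ _ s l
    exact (congrArg (Function.invFun bits) hread).trans (Function.leftInverse_invFun hinj w1)
  · have hread : destRead f θ k K G (fun t : Fin (2 * (G + 6)) =>
        destRx2 (pipelinedCode n m f θ k K G bits) w1 w2 t) = bits w2 := by
      simp only [destRx2, relayTxAt2_eq]
      refine destRead_eq h hk hK hKf (bits w2) (bits w1) (hbits w2)
        (relayRxAt2 (pipelinedCode n m f θ k K G bits) w1 w2) fun s l => ?_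
      rw [relayRxAt2_eq, hX, add_comm]
      exact relaySignal_eq_received h _ _ s l
    exact (congrArg (Function.invFun bits) hread).trans (Function.leftInverse_invFun hinj w2)

end Scheme

lemma exists_injective_bits {M G K : ℕ} (hM : M ≤ 2 ^ (G * K)) :
    ∃ bits : Fin M → ℕ → ℕ → ZMod 2, Function.Injective bits ∧
      ∀ w g J, ¬ (3 ≤ g ∧ g < G + 3 ∧ J < K) → bits w g J = 0 := by
  have hcard : Fintype.card (Fin M) ≤ Fintype.card (Fin G → Fin K → ZMod 2) := by
    simpa only [Fintype.card_fun, Fintype.card_fin, ZMod.card, ← pow_mul, mul_comm K G] using hM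
  obtain ⟨e⟩ := Function.Embedding.nonempty_of_card_le hcard
  refine ⟨fun w g J => if h : 3 ≤ g ∧ g < G + 3 ∧ J < K then
    e w ⟨g - 3, by omega⟩ ⟨J, h.2.2⟩ else 0, fun w w' hw => e.injective ?_,
    fun w g J h => dif_neg h⟩
  ext g J
  have := congrFun (congrFun hw (g + 3)) J
  have hgJ : 3 ≤ g.val + 3 ∧ g.val + 3 < G + 3 ∧ J.val < K := by omega
  simp only [dif_pos hgJ, Nat.add_sub_cancel] at this
  rw [this]

/-- Under cross-link overhearing in the weak interference regime, all symmetric rate pairs of sum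
rate below `min(2f, 2n - m, 2 max(m, n - m) + 2θ)` are achievable. -/
lemma achievable_cross {f θ : ℕ} (h : 3 * m ≤ 2 * n) {R : ℝ} (hR : 0 ≤ R)
    (hRK : 2 * R < (min (2 * f) (min (2 * n - m) (2 * max m (n - m) + 2 * θ)) : ℕ)) :
    Achievable n m f 0 θ R R := by
  refine ⟨hR, hR, fun ε hε => ?_⟩
  generalize hK : min (2 * f) (min (2 * n - m) (2 * max m (n - m) + 2 * θ)) = K at hRK
  obtain ⟨G, hG⟩ := exists_nat_ge (12 * R / (K - 2 * R))
  rw [div_le_iff₀ (by linarith)] at hG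
  have hM : ⌈(2 : ℝ) ^ (((2 * (G + 6) : ℕ) : ℝ) * R)⌉₊ ≤ 2 ^ (G * K) := by
    refine Nat.ceil_le.2 ?_
    rw [Nat.cast_pow, Nat.cast_ofNat, ← Real.rpow_natCast]
    refine Real.rpow_le_rpow_of_exponent_le one_le_two ?_
    push_cast
    linarith
  obtain ⟨bits, hinj, hbits⟩ := exists_injective_bits hM
  have : Nonempty (Fin ⌈(2 : ℝ) ^ (((2 * (G + 6) : ℕ) : ℝ) * R)⌉₊) := ⟨⟨0, ceil_rpow_pos _⟩⟩
  refine ⟨2 * (G + 6), by omega,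
    pipelinedCode n m f θ (min (min m (n - m) - (2 * m - n)) (2 * θ)) K G bits, ?_⟩
  rw [errProb_pipelinedCode bits h (by omega) (by omega) (by omega) (by omega) hinj hbits]
  exact hε.le

end Achievability

lemma bddAbove_sumRates (n m f nb mb : ℕ) :
    BddAbove {r : ℝ | ∃ R1 R2 : ℝ, Achievable n m f nb mb R1 R2 ∧ r = R1 + R2} := by
  refine ⟨(2 * f : ℕ), ?_⟩
  rintro r ⟨R1, R2, h, rfl⟩
  exact h.add_le_of_card_le fun N M1 M2 C => card_decodes_le_secondHop C

/-- The sum capacity under cross-link overhearing in the weak interference regime is at least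
`min(2f, 2n - m, 2 max(m, n - m) + 2θ)`. -/
lemma le_sumCapacity_cross {n m : ℕ} (f θ : ℕ) (h : 3 * m ≤ 2 * n) :
    (min (2 * f) (min (2 * n - m) (2 * max m (n - m) + 2 * θ)) : ℕ) ≤
      sumCapacity n m f 0 θ := by
  refine le_of_forall_lt fun r hr => ?_
  obtain ⟨r', hrr', hr'⟩ := exists_between hr
  rcases lt_or_ge r' 0 with hneg | hnonneg
  · refine (hrr'.trans hneg).trans_le (Real.sSup_nonneg ?_)
    rintro x ⟨R1, R2, hA, rfl⟩
    exact add_nonneg hA.1 hA.2.1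
  · refine hrr'.trans_le (le_csSup (bddAbove_sumRates n m f 0 θ) ⟨r' / 2, r' / 2, ?_, by ring⟩)
    exact achievable_cross h (by linarith) (by linarith)

end TwoHopIC

open TwoHopIC in
/-- Overhearing the cross-link is better in the weak interference regime:
the sum capacity with `(n̄, m̄) = (0, θ)` dominates that with `(n̄, m̄) = (θ, 0)`. -/
theorem crosslink_better_weak (n m f θ : ℕ) (h : 3 * m ≤ 2 * n) :
    sumCapacity n m f θ 0 ≤ sumCapacity n m f 0 θ := by
  refine le_trans (Real.sSup_le ?_ (Nat.cast_nonneg _)) (le_sumCapacity_cross f θ h)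
  rintro r ⟨R1, R2, hA, rfl⟩
  exact hA.add_le_direct (by omega)
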